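/- Two proper screws are ℝ-linearly dependent iff they share the same axis and the same pitch: let z₁, z₂ : Fin 3 → 𝔻 with π(z₁) ≠ 0 and π(z₂) ≠ 0; then there exists a real number r ≠ 0 with z₂ = r • z₁ if and only if Axis(z₁) = Axis(z₂) (as subsets of Fin 3 → ℝ) and p(z₁) = p(z₂). -/

import Mathlib

open Matrix DualNumber TrivSqZeroExt

/-- The dual dot product on `Fin 3 → 𝔻`. -/
def ddot (x y : Fin 3 → DualNumber ℝ) : DualNumber ℝ := ∑ i, x i * y i

/-- The resultant (projection to the real part) of an element of `Fin 3 → 𝔻`. -/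
def res (z : Fin 3 → DualNumber ℝ) : Fin 3 → ℝ := fun i => fst (z i)

/-- The screw vector field on Euclidean space induced by an element of `Fin 3 → 𝔻`. -/
def screwField (z : Fin 3 → DualNumber ℝ) (P : Fin 3 → ℝ) : Fin 3 → ℝ :=
  (fun i => snd (z i)) + res z ⨯₃ P

/-- The screw axis of a proper element of `Fin 3 → 𝔻`. -/
def screwAxis (z : Fin 3 → DualNumber ℝ) : Set (Fin 3 → ℝ) :=
  {P | ∃ t : ℝ, screwField z P = t • res z}

/-- The pitch of a proper element of `Fin 3 → 𝔻`. -/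
noncomputable def pitch (z : Fin 3 → DualNumber ℝ) : ℝ :=
  snd (ddot z z) / (2 * fst (ddot z z))

lemma aux_pos (z : Fin 3 → DualNumber ℝ) (h : res z ≠ 0) :
    0 < fst (z 0) ^ 2 + fst (z 1) ^ 2 + fst (z 2) ^ 2 := by
  by_contra hn
  apply h
  have h0 := sq_nonneg (fst (z 0))
  have h1 := sq_nonneg (fst (z 1))
  have h2 := sq_nonneg (fst (z 2))
  funext i
  fin_cases i
  · exact pow_eq_zero_iff (two_ne_zero) |>.1 (show fst (z 0) ^ 2 = 0 by linarith)
  · exact pow_eq_zero_iff (two_ne_zero) |>.1 (show fst (z 1) ^ 2 = 0 by linarith)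
  · exact pow_eq_zero_iff (two_ne_zero) |>.1 (show fst (z 2) ^ 2 = 0 by linarith)

lemma aux_pitch (z : Fin 3 → DualNumber ℝ) :
    pitch z = (fst (z 0) * snd (z 0) + fst (z 1) * snd (z 1) + fst (z 2) * snd (z 2)) /
      (fst (z 0) ^ 2 + fst (z 1) ^ 2 + fst (z 2) ^ 2) := by
  have e1 : snd (ddot z z) =
      2 * (fst (z 0) * snd (z 0) + fst (z 1) * snd (z 1) + fst (z 2) * snd (z 2)) := by
    simp [ddot, Fin.sum_univ_three]; ring
  have e2 : fst (ddot z z) = fst (z 0) ^ 2 + fst (z 1) ^ 2 + fst (z 2) ^ 2 := by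
    simp [ddot, Fin.sum_univ_three]; ring
  rw [pitch, e1, e2, mul_div_mul_left _ _ two_ne_zero]

lemma aux_field (z : Fin 3 → DualNumber ℝ) (P : Fin 3 → ℝ) (t : ℝ) :
    screwField z P = t • res z ↔
      (snd (z 0) + (fst (z 1) * P 2 - fst (z 2) * P 1) = t * fst (z 0) ∧
       snd (z 1) + (fst (z 2) * P 0 - fst (z 0) * P 2) = t * fst (z 1) ∧
       snd (z 2) + (fst (z 0) * P 1 - fst (z 1) * P 0) = t * fst (z 2)) := by
  rw [funext_iff, Fin.forall_fin_succ, Fin.forall_fin_succ, Fin.forall_fin_succ]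
  simp [screwField, res, cross_apply]

lemma aux_axis (z : Fin 3 → DualNumber ℝ) (h : res z ≠ 0) (P : Fin 3 → ℝ) :
    P ∈ screwAxis z ↔ screwField z P = pitch z • res z := by
  constructor
  · rintro ⟨t, ht⟩
    have : t = pitch z := by
      obtain ⟨e0, e1, e2⟩ := (aux_field z P t).1 ht
      rw [aux_pitch, eq_div_iff (aux_pos z h).ne']
      linear_combination -fst (z 0) * e0 - fst (z 1) * e1 - fst (z 2) * e2
    rw [← this]; exact ht
  · exact fun e => ⟨_, e⟩

lemma aux_point (z : Fin 3 → DualNumber ℝ) (h : res z ≠ 0) :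
    ∃ P, screwField z P = pitch z • res z := by
  have hp := (aux_pos z h).ne'
  refine ⟨(fst (z 0) ^ 2 + fst (z 1) ^ 2 + fst (z 2) ^ 2)⁻¹ •
    ![fst (z 1) * snd (z 2) - fst (z 2) * snd (z 1),
      fst (z 2) * snd (z 0) - fst (z 0) * snd (z 2),
      fst (z 0) * snd (z 1) - fst (z 1) * snd (z 0)], ?_⟩
  rw [aux_field, aux_pitch]
  simp only [Pi.smul_apply, smul_eq_mul, Matrix.cons_val]
  refine ⟨?_, ?_, ?_⟩ <;> field_simp <;> ring

theorem real_dependent_iff_same_axis_and_pitch (z₁ z₂ : Fin 3 → DualNumber ℝ)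
    (h₁ : res z₁ ≠ 0) (h₂ : res z₂ ≠ 0) :
    (∃ r : ℝ, r ≠ 0 ∧ z₂ = r • z₁) ↔
      (screwAxis z₁ = screwAxis z₂ ∧ pitch z₁ = pitch z₂) := by
  constructor
  · rintro ⟨r, hr, rfl⟩
    have hp := (aux_pos z₁ h₁).ne'
    have hpp : pitch z₁ = pitch (r • z₁) := by
      rw [aux_pitch, aux_pitch]
      simp only [Pi.smul_apply, fst_smul, snd_smul, smul_eq_mul]
      rw [← mul_div_mul_left _ _ (pow_ne_zero 2 hr)]
      congr 1 <;> ring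
    refine ⟨?_, hpp⟩
    ext P
    have e1 : res (r • z₁) = r • res z₁ := by
      funext i; simp [res]
    have e2 : screwField (r • z₁) P = r • screwField z₁ P := by
      rw [screwField, screwField, e1, smul_add, map_smul, LinearMap.smul_apply]
      congr 1
    rw [aux_axis _ h₁, aux_axis _ h₂, ← hpp, e1, e2, smul_comm (pitch z₁) r,
      (smul_right_injective (Fin 3 → ℝ) hr).eq_iff]
  · rintro ⟨hA, hp⟩
    obtain ⟨P, hP⟩ := aux_point z₁ h₁
    have key : ∀ Q, screwField z₁ Q = pitch z₁ • res z₁ →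
        screwField z₂ Q = pitch z₁ • res z₂ := by
      intro Q hQ
      rw [← aux_axis z₁ h₁, hA, aux_axis z₂ h₂, ← hp] at hQ
      exact hQ
    have hP2 := key P hP
    have hQ2 := key (P + res z₁) (by
      rw [← hP]; simp [screwField])
    have hpos := (aux_pos z₁ h₁).ne'
    rw [aux_field] at hP hP2 hQ2
    simp only [Pi.add_apply, res] at hQ2
    obtain ⟨a0, a1, a2⟩ := hP
    obtain ⟨b0, b1, b2⟩ := hP2
    obtain ⟨c0, c1, c2⟩ := hQ2
    have d0 : fst (z₂ 1) * fst (z₁ 2) - fst (z₂ 2) * fst (z₁ 1) = 0 := by linear_combination c0 - b0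
    have d1 : fst (z₂ 2) * fst (z₁ 0) - fst (z₂ 0) * fst (z₁ 2) = 0 := by linear_combination c1 - b1
    have d2 : fst (z₂ 0) * fst (z₁ 1) - fst (z₂ 1) * fst (z₁ 0) = 0 := by linear_combination c2 - b2
    obtain ⟨r, hr⟩ : ∃ r, r = (fst (z₁ 0) * fst (z₂ 0) + fst (z₁ 1) * fst (z₂ 1) +
      fst (z₁ 2) * fst (z₂ 2)) / (fst (z₁ 0) ^ 2 + fst (z₁ 1) ^ 2 + fst (z₁ 2) ^ 2) := ⟨_, rfl⟩
    rw [eq_div_iff hpos] at hr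
    have f0 : fst (z₂ 0) = r * fst (z₁ 0) := by
      apply mul_right_cancel₀ hpos
      linear_combination (-fst (z₁ 0)) * hr + fst (z₁ 1) * d2 - fst (z₁ 2) * d1
    have f1 : fst (z₂ 1) = r * fst (z₁ 1) := by
      apply mul_right_cancel₀ hpos
      linear_combination (-fst (z₁ 1)) * hr + fst (z₁ 2) * d0 - fst (z₁ 0) * d2
    have f2 : fst (z₂ 2) = r * fst (z₁ 2) := by
      apply mul_right_cancel₀ hpos
      linear_combination (-fst (z₁ 2)) * hr + fst (z₁ 0) * d1 - fst (z₁ 1) * d0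
    have hz : z₂ = r • z₁ := by
      rw [f0, f1, f2] at b0 b1 b2
      funext i
      fin_cases i
      · refine TrivSqZeroExt.ext (by simpa using f0) ?_
        simp; linear_combination b0 - r * a0
      · refine TrivSqZeroExt.ext (by simpa using f1) ?_
        simp; linear_combination b1 - r * a1
      · refine TrivSqZeroExt.ext (by simpa using f2) ?_
        simp; linear_combination b2 - r * a2
    refine ⟨r, ?_, hz⟩
    rintro rfl
    apply h₂
    funext i
    rw [hz]; simp [res]
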